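/- arXiv:2006.03192 — 4 statements merged into one kernel-verified Lean document; each statement's English description precedes it below -/
import Mathlib

section
/- Let μ : ℝ → ℝ satisfy 0 < m ≤ μ(t) ≤ M for all t ∈ ℝ and be (γ,κ)-Hölder continuous, i.e. |μ(t) − μ(τ)| ≤ κ|t − τ|^γ for all t, τ ∈ ℝ, with γ ∈ [1/2, 1] and κ > 0. Then there exists a constant κ' > 0, independent of α, such that for every α ∈ (0, 1] and all t, τ ∈ ℝ, |μ(t)^{α/2} − μ(τ)^{α/2}| ≤ κ'·|t − τ|^{1/4}. -/
/-- A power with exponent in `[0, 1]` is at most `1 + M` on `[0, M]`. -/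
theorem Real.rpow_le_one_add_of_le {x M β : ℝ} (hx : 0 ≤ x) (hxM : x ≤ M)
    (hβ : 0 ≤ β) (hβ1 : β ≤ 1) : x ^ β ≤ 1 + M := by
  rcases le_total x 1 with h | h
  · linarith [Real.rpow_le_one hx h hβ]
  · linarith [Real.rpow_le_self_of_one_le h hβ1]

/-- On `[m, M]` with `0 < m`, the powers with exponent in `[0, 1]` are Lipschitz with a constant
that does not depend on the exponent. -/
theorem Real.abs_rpow_sub_rpow_le {x y m M β : ℝ} (hm : 0 < m) (hx : x ∈ Set.Icc m M)
    (hy : y ∈ Set.Icc m M) (hβ : 0 ≤ β) (hβ1 : β ≤ 1) :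
    |x ^ β - y ^ β| ≤ (1 + M) / m * |x - y| := by
  wlog hyx : y ≤ x generalizing x y
  · rw [abs_sub_comm, abs_sub_comm x]
    exact this hy hx (le_of_not_ge hyx)
  have hy0 : 0 < y := hm.trans_le hy.1
  have hpow : 0 < y ^ β := Real.rpow_pos_of_pos hy0 β
  have hquot : (x / y) ^ β ≤ x / y :=
    Real.rpow_le_self_of_one_le ((one_le_div hy0).2 hyx) hβ1
  rw [abs_of_nonneg (sub_nonneg.2 (Real.rpow_le_rpow hy0.le hyx hβ)),
    abs_of_nonneg (sub_nonneg.2 hyx)]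
  calc x ^ β - y ^ β = y ^ β * ((x / y) ^ β - 1) := by
        rw [Real.div_rpow (hy0.le.trans hyx) hy0.le]
        field_simp
    _ ≤ y ^ β * (x / y - 1) := by gcongr
    _ = y ^ β / y * (x - y) := by field_simp
    _ ≤ (1 + M) / m * (x - y) := by
        have hM : y ^ β ≤ 1 + M := Real.rpow_le_one_add_of_le hy0.le hy.2 hβ hβ1
        have hmy : m ≤ y := hy.1
        have hxy : 0 ≤ x - y := sub_nonneg.2 hyx
        have h1M : 0 ≤ 1 + M := hpow.le.trans hM
        gcongr

/-- Uniform `(1/4)`-Hölder continuity of `t ↦ μ(t)^{α/2}` (Bezerra–Nascimento,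
Lemma 3.6): if `0 < m ≤ μ(t) ≤ M` and `μ` is `(γ,κ)`-Hölder with `γ ∈ [1/2,1]`,
then there is `κ' > 0`, independent of `α`, with
`|μ(t)^{α/2} − μ(τ)^{α/2}| ≤ κ'|t − τ|^{1/4}` for all `α ∈ (0,1]`. -/
theorem stmt5 (μ : ℝ → ℝ) (m M γ κ : ℝ) (hm : 0 < m)
    (hbound : ∀ t : ℝ, m ≤ μ t ∧ μ t ≤ M)
    (hγ : γ ∈ Set.Icc (1/2 : ℝ) 1) (hκ : 0 < κ)
    (hHolder : ∀ t τ : ℝ, |μ t - μ τ| ≤ κ * |t - τ| ^ γ) :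
    ∃ κ' > 0, ∀ α ∈ Set.Ioc (0:ℝ) 1, ∀ t τ : ℝ,
      |μ t ^ (α / 2) - μ τ ^ (α / 2)| ≤ κ' * |t - τ| ^ ((1:ℝ)/4) := by
  have hM : 0 < 1 + M := by linarith [(hbound 0).1, (hbound 0).2]
  refine ⟨(1 + M) / m * κ + (1 + M), by positivity, fun α hα t τ => ?_⟩
  have hα0 : 0 ≤ α / 2 := by linarith [hα.1]
  have hα1 : α / 2 ≤ 1 := by linarith [hα.2]
  have ht : 0 < μ t := hm.trans_le (hbound t).1
  have hτ : 0 < μ τ := hm.trans_le (hbound τ).1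
  rw [add_mul]
  rcases le_total |t - τ| 1 with h | h
  · refine le_add_of_le_of_nonneg ?_ (by positivity)
    calc |μ t ^ (α / 2) - μ τ ^ (α / 2)| ≤ (1 + M) / m * |μ t - μ τ| :=
          Real.abs_rpow_sub_rpow_le hm (hbound t) (hbound τ) hα0 hα1
      _ ≤ (1 + M) / m * (κ * |t - τ| ^ γ) := by
          gcongr
          exact hHolder t τ
      _ ≤ (1 + M) / m * (κ * |t - τ| ^ ((1 : ℝ) / 4)) := by
          gcongr ?_ * (?_ * ?_)
          exact Real.rpow_le_rpow_of_exponent_ge_of_imp (abs_nonneg _) h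
            (by linarith [hγ.1]) (fun _ h0 => by linarith [hγ.1])
      _ = (1 + M) / m * κ * |t - τ| ^ ((1 : ℝ) / 4) := by ring
  · refine le_add_of_nonneg_of_le (by positivity) ?_
    calc |μ t ^ (α / 2) - μ τ ^ (α / 2)| ≤ 1 + M :=
          abs_sub_le_of_nonneg_of_le (by positivity)
            (Real.rpow_le_one_add_of_le ht.le (hbound t).2 hα0 hα1) (by positivity)
            (Real.rpow_le_one_add_of_le hτ.le (hbound τ).2 hα0 hα1)
      _ ≤ (1 + M) * |t - τ| ^ ((1 : ℝ) / 4) :=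
          le_mul_of_one_le_right hM.le (Real.one_le_rpow h (by norm_num))
end

section
/- Let 0 < m ≤ M and α ∈ (0, 1]. Then for all a, b ∈ [m, M], |a^{(α−1)/2} − b^{(α−1)/2}| ≤ m^{−1/2}·|a^{α/2} − b^{α/2}| + max(1, M^{1/2})·m^{−1}·|a^{1/2} − b^{1/2}|. -/
/-- Scalar power-difference inequality used in Theorem 4.4 for the
negative-exponent power `μ^{(−1+α)/2}`. -/
theorem stmt6 (m M α : ℝ) (hm : 0 < m) (hmM : m ≤ M) (hα : α ∈ Set.Ioc (0:ℝ) 1) :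
    ∀ a ∈ Set.Icc m M, ∀ b ∈ Set.Icc m M,
      |a ^ ((α - 1) / 2) - b ^ ((α - 1) / 2)| ≤
        m ^ (-(1:ℝ)/2) * |a ^ (α / 2) - b ^ (α / 2)| +
          max 1 (M ^ ((1:ℝ)/2)) * m⁻¹ * |a ^ ((1:ℝ)/2) - b ^ ((1:ℝ)/2)| := by
  rintro a ⟨hma, haM⟩ b ⟨hmb, hbM⟩
  obtain ⟨hα0, hα1⟩ := hα
  have ha : 0 < a := hm.trans_le hma
  have hb : 0 < b := hm.trans_le hmb
  have hsa : 0 < a ^ ((1:ℝ)/2) := Real.rpow_pos_of_pos ha _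
  have hsb : 0 < b ^ ((1:ℝ)/2) := Real.rpow_pos_of_pos hb _
  have hsm : 0 < m ^ ((1:ℝ)/2) := Real.rpow_pos_of_pos hm _
  have hsma : m ^ ((1:ℝ)/2) ≤ a ^ ((1:ℝ)/2) := by gcongr
  have hsmb : m ^ ((1:ℝ)/2) ≤ b ^ ((1:ℝ)/2) := by gcongr
  have hmm : m ^ ((1:ℝ)/2) * m ^ ((1:ℝ)/2) = m := by
    rw [← Real.rpow_add hm]; norm_num
  have hinv : m ^ (-(1:ℝ)/2) = (m ^ ((1:ℝ)/2))⁻¹ := by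
    rw [neg_div, Real.rpow_neg hm.le]
  have split : ∀ x : ℝ, 0 < x → x ^ ((α - 1) / 2) = x ^ (α / 2) / x ^ ((1:ℝ)/2) := by
    intro x hx
    rw [sub_div, Real.rpow_sub hx]
  have hbα : b ^ (α / 2) ≤ max 1 (M ^ ((1:ℝ)/2)) := by
    rcases le_total b 1 with h | h
    · exact (Real.rpow_le_one hb.le h (by linarith)).trans (le_max_left _ _)
    · refine le_trans ?_ (le_max_right _ _)
      calc b ^ (α / 2) ≤ b ^ ((1:ℝ)/2) := Real.rpow_le_rpow_of_exponent_le h (by linarith)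
        _ ≤ M ^ ((1:ℝ)/2) := by gcongr
  have hprod : (a ^ ((1:ℝ)/2) * b ^ ((1:ℝ)/2))⁻¹ ≤ m⁻¹ := by
    apply inv_anti₀ hm
    calc m = m ^ ((1:ℝ)/2) * m ^ ((1:ℝ)/2) := hmm.symm
      _ ≤ _ := by gcongr
  have key : a ^ ((α - 1) / 2) - b ^ ((α - 1) / 2) =
      (a ^ ((1:ℝ)/2))⁻¹ * (a ^ (α / 2) - b ^ (α / 2)) -
        b ^ (α / 2) * (a ^ ((1:ℝ)/2) * b ^ ((1:ℝ)/2))⁻¹ *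
          (a ^ ((1:ℝ)/2) - b ^ ((1:ℝ)/2)) := by
    rw [split a ha, split b hb]
    generalize a ^ ((1:ℝ)/2) = u at *
    generalize b ^ ((1:ℝ)/2) = v at *
    field_simp
    ring
  rw [key, hinv]
  refine (abs_sub _ _).trans ?_
  rw [abs_mul, abs_mul, abs_of_pos (inv_pos.2 hsa),
    abs_of_nonneg (by positivity : 0 ≤ b ^ (α / 2) * (a ^ ((1:ℝ)/2) * b ^ ((1:ℝ)/2))⁻¹)]
  gcongr
end

section
/- Let μ, ν > 0 and α ∈ (0, 1]. Write c = cos(πα/2), s = sin(πα/2), and let P be the 2×2 complex matrix with rows (μ^{α/2}·c·ν^{α/2}, −μ^{(α−1)/2}·s·ν^{(α−1)/2}) and (μ^{(1+α)/2}·s·ν^{(1+α)/2}, μ^{α/2}·c·ν^{α/2}). Then the set of eigenvalues of −P is exactly {e^{iπ(2−α)/2}·μ^{α/2}·ν^{α/2}, e^{−iπ(2−α)/2}·μ^{α/2}·ν^{α/2}}. -/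
/-- A `2 × 2` matrix with constant diagonal `a` and off-diagonal product `z ^ 2` has spectrum
`{a + z, a - z}`. -/
theorem spectrum_fin_two_of_mul_eq_sq {K : Type*} [Field K] {a b d z : K} (h : b * d = z ^ 2) :
    spectrum K !![a, b; d, a] = {a + z, a - z} := by
  ext k
  have hdet : (algebraMap K (Matrix (Fin 2) (Fin 2) K) k - !![a, b; d, a]).det
      = (k - (a + z)) * (k - (a - z)) := by
    simp only [Matrix.det_fin_two, Matrix.sub_apply, Matrix.algebraMap_matrix_apply]
    simp
    linear_combination -h
  rw [spectrum.mem_iff, Matrix.isUnit_iff_isUnit_det, hdet, isUnit_iff_ne_zero, not_not,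
    mul_eq_zero, sub_eq_zero, sub_eq_zero, Set.mem_insert_iff, Set.mem_singleton_iff]

theorem rpow_half_sub_mul_rpow_half_add {x : ℝ} (hx : 0 < x) (α : ℝ) :
    x ^ ((α - 1) / 2) * x ^ ((1 + α) / 2) = (x ^ (α / 2)) ^ 2 := by
  rw [sq, ← Real.rpow_add hx, ← Real.rpow_add hx]
  congr 1
  ring

theorem exp_I_mul_pi_mul_two_sub (α : ℝ) :
    Complex.exp (Complex.I * (Real.pi * (2 - α) / 2)) =
      -(Real.cos (Real.pi * α / 2) : ℂ) + Complex.I * (Real.sin (Real.pi * α / 2) : ℂ) := by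
  have h : Complex.I * (Real.pi * (2 - α) / 2) =
      ((Real.pi - Real.pi * α / 2 : ℝ) : ℂ) * Complex.I := by
    push_cast
    ring
  rw [h, Complex.exp_mul_I, ← Complex.ofReal_cos, ← Complex.ofReal_sin, Real.cos_pi_sub,
    Real.sin_pi_sub]
  push_cast
  ring

theorem exp_neg_I_mul_pi_mul_two_sub (α : ℝ) :
    Complex.exp (-(Complex.I * (Real.pi * (2 - α) / 2))) =
      -(Real.cos (Real.pi * α / 2) : ℂ) - Complex.I * (Real.sin (Real.pi * α / 2) : ℂ) := by
  have h : -(Complex.I * (Real.pi * (2 - α) / 2)) =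
      ((Real.pi * α / 2 - Real.pi : ℝ) : ℂ) * Complex.I := by
    push_cast
    ring
  rw [h, Complex.exp_mul_I, ← Complex.ofReal_cos, ← Complex.ofReal_sin, Real.cos_sub_pi,
    Real.sin_sub_pi]
  push_cast
  ring

/-- Eigenspace-level content of Lemma 3.1(vii): the spectrum of `−P`, where `P`
is the matrix representation of `Λ(t)^α` on an eigenspace of the Dirichlet
Laplacian with eigenvalue `ν`, is `{e^{±iπ(2−α)/2} μ^{α/2} ν^{α/2}}`. -/
theorem stmt9 (μ ν α : ℝ) (hμ : 0 < μ) (hν : 0 < ν) (hα : α ∈ Set.Ioc (0:ℝ) 1) :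
    let c : ℝ := Real.cos (Real.pi * α / 2)
    let s : ℝ := Real.sin (Real.pi * α / 2)
    let P : Matrix (Fin 2) (Fin 2) ℂ :=
      !![((μ ^ (α/2) * c * ν ^ (α/2) : ℝ) : ℂ),
         ((-(μ ^ ((α-1)/2) * s * ν ^ ((α-1)/2)) : ℝ) : ℂ);
         ((μ ^ ((1+α)/2) * s * ν ^ ((1+α)/2) : ℝ) : ℂ),
         ((μ ^ (α/2) * c * ν ^ (α/2) : ℝ) : ℂ)]
    spectrum ℂ (-P) =
      {Complex.exp (Complex.I * (Real.pi * (2 - α) / 2)) * ((μ ^ (α/2) * ν ^ (α/2) : ℝ) : ℂ),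
       Complex.exp (-(Complex.I * (Real.pi * (2 - α) / 2))) * ((μ ^ (α/2) * ν ^ (α/2) : ℝ) : ℂ)} := by
  intro c s P
  have hP : -P = !![-((μ ^ (α/2) * c * ν ^ (α/2) : ℝ) : ℂ),
      ((μ ^ ((α-1)/2) * s * ν ^ ((α-1)/2) : ℝ) : ℂ);
      -((μ ^ ((1+α)/2) * s * ν ^ ((1+α)/2) : ℝ) : ℂ),
      -((μ ^ (α/2) * c * ν ^ (α/2) : ℝ) : ℂ)] := by
    ext i j
    fin_cases i <;> fin_cases j <;> simp [P]
  have hreal : (μ ^ ((α-1)/2) * s * ν ^ ((α-1)/2)) * (μ ^ ((1+α)/2) * s * ν ^ ((1+α)/2)) =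
      (μ ^ (α/2) * s * ν ^ (α/2)) ^ 2 := by
    calc _ = (μ ^ ((α-1)/2) * μ ^ ((1+α)/2)) * s ^ 2 * (ν ^ ((α-1)/2) * ν ^ ((1+α)/2)) := by ring
      _ = _ := by
        rw [rpow_half_sub_mul_rpow_half_add hμ, rpow_half_sub_mul_rpow_half_add hν]
        ring
  have hprod : ((μ ^ ((α-1)/2) * s * ν ^ ((α-1)/2) : ℝ) : ℂ) *
      -((μ ^ ((1+α)/2) * s * ν ^ ((1+α)/2) : ℝ) : ℂ) =
      (Complex.I * ((μ ^ (α/2) * s * ν ^ (α/2) : ℝ) : ℂ)) ^ 2 := by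
    rw [mul_neg, ← Complex.ofReal_mul, hreal, mul_pow Complex.I, Complex.I_sq, Complex.ofReal_pow]
    ring
  rw [hP, spectrum_fin_two_of_mul_eq_sq hprod, exp_I_mul_pi_mul_two_sub,
    exp_neg_I_mul_pi_mul_two_sub]
  congr 1
  · simp only [Complex.ofReal_mul, c, s]
    ring
  · congr 1
    simp only [Complex.ofReal_mul, c, s]
    ring
end

section
/- Let μ, ν > 0 and let Λ be the 2×2 real matrix with rows (0, −1) and (μν, 0). Then for every λ > 0 the matrix λI + Λ is invertible with (λI + Λ)^{−1} = (λ² + μν)^{−1} · [[λ, 1], [−μν, λ]]; moreover, for every α ∈ (0,1) the matrix-valued function λ ↦ λ^{−α}(λI + Λ)^{−1} is integrable on (0, ∞) and (sin(πα)/π) · ∫₀^∞ λ^{−α}(λI + Λ)^{−1} dλ = Q, where Q is the 2×2 matrix with rows (μ^{−α/2}·cos(πα/2)·ν^{−α/2}, μ^{−(1+α)/2}·sin(πα/2)·ν^{−(1+α)/2}) and (−μ^{(1−α)/2}·sin(πα/2)·ν^{(1−α)/2}, μ^{−α/2}·cos(πα/2)·ν^{−α/2}). -/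
open MeasureTheory Set

/-- The Beta integrand `u ^ (s - 1) * (1 - u) ^ (-s)` is integrable on `(0, 1)` with integral
`π / sin (π s)`. -/
theorem integral_rpow_sub_one_mul_one_sub_rpow_neg {s : ℝ} (hs : s ∈ Ioo (0 : ℝ) 1) :
    IntegrableOn (fun u : ℝ => u ^ (s - 1) * (1 - u) ^ (-s)) (Ioo 0 1) ∧
      ∫ u in Ioo (0 : ℝ) 1, u ^ (s - 1) * (1 - u) ^ (-s) =
        Real.pi / Real.sin (Real.pi * s) := by
  have h1 : 0 < (s : ℂ).re := by simpa using hs.1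
  have h2 : 0 < (1 - s : ℂ).re := by simpa using hs.2
  have heq : EqOn (fun u : ℝ => (u : ℂ) ^ ((s : ℂ) - 1) * (1 - (u : ℂ)) ^ ((1 - s : ℂ) - 1))
      (fun u : ℝ => ((u ^ (s - 1) * (1 - u) ^ (-s) : ℝ) : ℂ)) (Ioo 0 1) := by
    intro u hu
    simp only [Complex.ofReal_mul]
    rw [Complex.ofReal_cpow hu.1.le, Complex.ofReal_cpow (sub_pos.2 hu.2).le]
    push_cast
    congr 2
    ring
  have hint := Complex.betaIntegral_convergent h1 h2
  rw [intervalIntegrable_iff_integrableOn_Ioo_of_le zero_le_one,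
    integrableOn_congr_fun heq measurableSet_Ioo] at hint
  refine ⟨by simpa [IntegrableOn] using hint.re, ?_⟩
  have hbeta := Complex.Gamma_mul_Gamma_eq_betaIntegral h1 h2
  rw [add_sub_cancel, Complex.Gamma_one, one_mul, Complex.Gamma_mul_Gamma_one_sub,
    Complex.betaIntegral, intervalIntegral.integral_of_le zero_le_one, integral_Ioc_eq_integral_Ioo,
    setIntegral_congr_fun measurableSet_Ioo heq, integral_complex_ofReal] at hbeta
  exact_mod_cast hbeta.symm

/-- The substitution `u = x ^ 2 / (c + x ^ 2)` maps `(0, ∞)` onto `(0, 1)`. -/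
theorem image_sq_div_add_sq_Ioi {c : ℝ} (hc : 0 < c) :
    (fun x : ℝ => x ^ 2 / (c + x ^ 2)) '' Ioi 0 = Ioo 0 1 := by
  ext u
  constructor
  · rintro ⟨x, hx, rfl⟩
    have hx : 0 < x := hx
    exact ⟨by positivity, (div_lt_one (by positivity)).2 (by linarith)⟩
  · rintro ⟨h0, h1⟩
    have h1' : 0 < 1 - u := sub_pos.2 h1
    refine ⟨√(c * u / (1 - u)), Real.sqrt_pos.2 (by positivity), ?_⟩
    have h : 0 ≤ c * u / (1 - u) := by positivity
    simp only [Real.sq_sqrt h]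
    field_simp
    ring

theorem injOn_sq_div_add_sq_Ioi {c : ℝ} (hc : 0 < c) :
    InjOn (fun x : ℝ => x ^ 2 / (c + x ^ 2)) (Ioi 0) := by
  intro x hx y hy h
  have hx : 0 < x := hx
  have hy : 0 < y := hy
  have hsq : x ^ 2 = y ^ 2 := by
    simp only at h
    rw [div_eq_div_iff (by positivity) (by positivity)] at h
    exact mul_left_cancel₀ hc.ne' (by linarith)
  exact (pow_left_inj₀ hx.le hy.le two_ne_zero).1 hsq

theorem hasDerivAt_sq_div_add_sq {c : ℝ} (hc : 0 < c) (x : ℝ) :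
    HasDerivAt (fun x : ℝ => x ^ 2 / (c + x ^ 2)) (2 * c * x / (c + x ^ 2) ^ 2) x := by
  have hne : c + x ^ 2 ≠ 0 := by positivity
  have hsq : HasDerivAt (fun x : ℝ => x ^ 2) (2 * x) x := by simpa using hasDerivAt_pow 2 x
  refine (hsq.div (hsq.const_add c) hne).congr_deriv ?_
  ring

/-- The pullback of the Beta integrand under `u = x ^ 2 / (c + x ^ 2)`. -/
theorem deriv_mul_beta_integrand_sq_div_add_sq {c x : ℝ} (hc : 0 < c) (hx : 0 < x) (s : ℝ) :
    |2 * c * x / (c + x ^ 2) ^ 2| •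
        ((x ^ 2 / (c + x ^ 2)) ^ (s - 1) * (1 - x ^ 2 / (c + x ^ 2)) ^ (-s)) =
      2 * c ^ (1 - s) * (x ^ (2 * s - 1) / (c + x ^ 2)) := by
  have hd : 0 < c + x ^ 2 := by positivity
  have h1 : 1 - x ^ 2 / (c + x ^ 2) = c / (c + x ^ 2) := by
    field_simp
    ring
  have hxpow : (x ^ 2) ^ (s - 1) * x = x ^ (2 * s - 1) := by
    rw [← Real.rpow_natCast x 2, ← Real.rpow_mul hx.le, ← Real.rpow_add_one hx.ne']
    congr 1
    push_cast
    ring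
  have hcpow : c ^ (1 - s) = c * c ^ (-s) := by
    rw [sub_eq_add_neg, Real.rpow_add hc, Real.rpow_one]
  have hdpow : (c + x ^ 2) ^ (s - 1) * (c + x ^ 2) ^ (-s) = (c + x ^ 2)⁻¹ := by
    rw [← Real.rpow_add hd, ← Real.rpow_neg_one]
    congr 1
    ring
  rw [abs_of_pos (by positivity), h1, Real.div_rpow (by positivity) hd.le,
    Real.div_rpow hc.le hd.le, smul_eq_mul, div_mul_div_comm, hdpow, ← hxpow, hcpow]
  field_simp

/-- For `0 < s < 1` and `c > 0`, the function `x ^ (2 s - 1) / (c + x ^ 2)` is integrable on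
`(0, ∞)` with integral `c ^ (s - 1) π / (2 sin (π s))`. -/
theorem integral_rpow_div_add_sq_Ioi {c s : ℝ} (hc : 0 < c) (hs : s ∈ Ioo (0 : ℝ) 1) :
    IntegrableOn (fun x : ℝ => x ^ (2 * s - 1) / (c + x ^ 2)) (Ioi 0) ∧
      ∫ x in Ioi (0 : ℝ), x ^ (2 * s - 1) / (c + x ^ 2) =
        c ^ (s - 1) * (Real.pi / (2 * Real.sin (Real.pi * s))) := by
  obtain ⟨hint, hval⟩ := integral_rpow_sub_one_mul_one_sub_rpow_neg hs
  have hderiv : ∀ x ∈ Ioi (0 : ℝ), HasDerivWithinAt (fun x : ℝ => x ^ 2 / (c + x ^ 2))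
      (2 * c * x / (c + x ^ 2) ^ 2) (Ioi 0) x :=
    fun x _ => (hasDerivAt_sq_div_add_sq hc x).hasDerivWithinAt
  have heq : EqOn _ _ (Ioi (0 : ℝ)) :=
    fun x hx => deriv_mul_beta_integrand_sq_div_add_sq hc hx s
  rw [← image_sq_div_add_sq_Ioi hc] at hint hval
  rw [integrableOn_image_iff_integrableOn_abs_deriv_smul measurableSet_Ioi hderiv
    (injOn_sq_div_add_sq_Ioi hc), integrableOn_congr_fun heq measurableSet_Ioi] at hint
  rw [integral_image_eq_integral_abs_deriv_smul measurableSet_Ioi hderiv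
    (injOn_sq_div_add_sq_Ioi hc), setIntegral_congr_fun measurableSet_Ioi heq,
    integral_const_mul] at hval
  have hcs : 0 < c ^ (1 - s) := Real.rpow_pos_of_pos hc _
  refine ⟨(integrable_const_mul_iff (IsUnit.mk0 _ (by positivity)) _).1 hint, ?_⟩
  rw [← neg_sub 1 s, Real.rpow_neg hc.le, ← div_div, div_right_comm, ← hval]
  field_simp

theorem det_smul_one_add_wave (m l : ℝ) :
    (l • (1 : Matrix (Fin 2) (Fin 2) ℝ) + !![0, -1; m, 0]).det = l ^ 2 + m := by
  simp [Matrix.det_fin_two, sq]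

theorem inv_smul_one_add_wave (m l : ℝ) :
    (l • (1 : Matrix (Fin 2) (Fin 2) ℝ) + !![0, -1; m, 0])⁻¹ =
      (l ^ 2 + m)⁻¹ • !![l, 1; -m, l] := by
  rw [Matrix.inv_def, det_smul_one_add_wave, Ring.inverse_eq_inv', Matrix.adjugate_fin_two]
  congr 1
  ext i j
  fin_cases i <;> fin_cases j <;> simp


/-- Eigenspace-level computation proving Lemma 3.1(vi): resolvent formula for
the restricted wave operator `Λ = [[0,−1],[μν,0]]` and the Balakrishnan integral
`(sin(πα)/π) ∫₀^∞ λ^{−α}(λI + Λ)^{−1} dλ = Q`, entrywise. -/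
theorem stmt11 (μ ν : ℝ) (hμ : 0 < μ) (hν : 0 < ν) :
    let Λ : Matrix (Fin 2) (Fin 2) ℝ := !![0, -1; μ * ν, 0]
    (∀ l : ℝ, 0 < l →
        IsUnit (l • (1 : Matrix (Fin 2) (Fin 2) ℝ) + Λ) ∧
          (l • (1 : Matrix (Fin 2) (Fin 2) ℝ) + Λ)⁻¹ =
            (l ^ 2 + μ * ν)⁻¹ • !![l, 1; -(μ * ν), l]) ∧
      ∀ α ∈ Set.Ioo (0:ℝ) 1, ∀ i j : Fin 2,
        MeasureTheory.IntegrableOn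
            (fun l : ℝ => l ^ (-α) * ((l • (1 : Matrix (Fin 2) (Fin 2) ℝ) + Λ)⁻¹ i j))
            (Set.Ioi 0) ∧
          Real.sin (Real.pi * α) / Real.pi *
              (∫ l in Set.Ioi (0:ℝ),
                l ^ (-α) * ((l • (1 : Matrix (Fin 2) (Fin 2) ℝ) + Λ)⁻¹ i j)) =
            (!![μ ^ (-α/2) * Real.cos (Real.pi * α / 2) * ν ^ (-α/2),
                μ ^ (-(1+α)/2) * Real.sin (Real.pi * α / 2) * ν ^ (-(1+α)/2);
                -(μ ^ ((1-α)/2) * Real.sin (Real.pi * α / 2) * ν ^ ((1-α)/2)),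
                μ ^ (-α/2) * Real.cos (Real.pi * α / 2) * ν ^ (-α/2)] :
              Matrix (Fin 2) (Fin 2) ℝ) i j := by
  intro Λ
  have hm : 0 < μ * ν := mul_pos hμ hν
  refine ⟨fun l _ => ⟨?_, inv_smul_one_add_wave _ l⟩, ?_⟩
  · rw [Matrix.isUnit_iff_isUnit_det, det_smul_one_add_wave]
    exact IsUnit.mk0 _ (by positivity)
  rintro α ⟨h0, h1⟩
  have hsin : Real.sin (Real.pi * α) =
      2 * Real.sin (Real.pi * α / 2) * Real.cos (Real.pi * α / 2) := by
    rw [← Real.sin_two_mul]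
    ring_nf
  have hsin_pos : 0 < Real.sin (Real.pi * α / 2) :=
    Real.sin_pos_of_pos_of_lt_pi (by positivity) (by nlinarith [Real.pi_pos])
  have hcos_pos : 0 < Real.cos (Real.pi * α / 2) :=
    Real.cos_pos_of_mem_Ioo ⟨by nlinarith [Real.pi_pos], by nlinarith [Real.pi_pos]⟩
  obtain ⟨hdi, hdv⟩ := integral_rpow_div_add_sq_Ioi (s := 1 - α / 2) hm
    ⟨by linarith, by linarith⟩
  obtain ⟨hoi, hov⟩ := integral_rpow_div_add_sq_Ioi (s := (1 - α) / 2) hm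
    ⟨by linarith, by linarith⟩
  have hsd : Real.sin (Real.pi * (1 - α / 2)) = Real.sin (Real.pi * α / 2) := by
    rw [← Real.sin_pi_sub]
    ring_nf
  have hso : Real.sin (Real.pi * ((1 - α) / 2)) = Real.cos (Real.pi * α / 2) := by
    rw [← Real.sin_pi_div_two_sub]
    ring_nf
  rw [hsd, show 1 - α / 2 - 1 = -α / 2 by ring, Real.mul_rpow hμ.le hν.le] at hdv
  rw [hso, show (1 - α) / 2 - 1 = -(1 + α) / 2 by ring, Real.mul_rpow hμ.le hν.le] at hov
  have hdiag : EqOn (fun l : ℝ => l ^ (2 * (1 - α / 2) - 1) / (μ * ν + l ^ 2))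
      (fun l : ℝ => l ^ (-α) * ((l ^ 2 + μ * ν)⁻¹ * l)) (Ioi 0) := by
    intro l hl
    simp only
    rw [show 2 * (1 - α / 2) - 1 = -α + 1 by ring, Real.rpow_add_one (ne_of_gt hl)]
    ring
  have hoff : EqOn (fun l : ℝ => l ^ (2 * ((1 - α) / 2) - 1) / (μ * ν + l ^ 2))
      (fun l : ℝ => l ^ (-α) * (l ^ 2 + μ * ν)⁻¹) (Ioi 0) := by
    intro l _
    simp only
    rw [show 2 * ((1 - α) / 2) - 1 = -α by ring]
    ring
  rw [integrableOn_congr_fun hdiag measurableSet_Ioi] at hdi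
  rw [integrableOn_congr_fun hoff measurableSet_Ioi] at hoi
  rw [setIntegral_congr_fun measurableSet_Ioi hdiag] at hdv
  rw [setIntegral_congr_fun measurableSet_Ioi hoff] at hov
  have hpow : ∀ x : ℝ, 0 < x → x ^ ((1 - α) / 2) = x ^ (-(1 + α) / 2) * x := by
    intro x hx
    rw [← Real.rpow_add_one hx.ne']
    congr 1
    ring
  have hlower : (fun l : ℝ => l ^ (-α) * ((l ^ 2 + μ * ν)⁻¹ * -(μ * ν))) =
      fun l : ℝ => -(μ * ν) * (l ^ (-α) * (l ^ 2 + μ * ν)⁻¹) := by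
    ext l
    ring
  have hdval : Real.sin (Real.pi * α) / Real.pi *
      (∫ l in Ioi (0 : ℝ), l ^ (-α) * ((l ^ 2 + μ * ν)⁻¹ * l)) =
      μ ^ (-α / 2) * Real.cos (Real.pi * α / 2) * ν ^ (-α / 2) := by
    rw [hdv, hsin]
    field_simp
  have hoval : Real.sin (Real.pi * α) / Real.pi *
      (∫ l in Ioi (0 : ℝ), l ^ (-α) * (l ^ 2 + μ * ν)⁻¹) =
      μ ^ (-(1 + α) / 2) * Real.sin (Real.pi * α / 2) * ν ^ (-(1 + α) / 2) := by
    rw [hov, hsin]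
    field_simp
  intro i j
  simp only [Λ, inv_smul_one_add_wave, Matrix.smul_apply, smul_eq_mul]
  fin_cases i <;> fin_cases j <;>
    simp only [Fin.zero_eta, Fin.mk_one, Matrix.of_apply, Matrix.cons_val_zero,
      Matrix.cons_val_one, mul_one]
  · exact ⟨hdi, hdval⟩
  · exact ⟨hoi, hoval⟩
  · rw [hlower]
    refine ⟨hoi.const_mul _, ?_⟩
    rw [integral_const_mul, mul_left_comm, hoval, hpow μ hμ, hpow ν hν]
    ring
  · exact ⟨hdi, hdval⟩
end
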